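/- Let Y be a finite set, p a probability mass function on Y, Q a finite nonempty set of probability mass functions on Y (the safe models), and κ ≥ 0. Define the acceptance set A = {y ∈ Y : for every q ∈ Q, p(y) ≤ e^κ · q(y)}, the acceptance probability ν = Σ_{y ∈ A} p(y), and assume ν > 0. Define the CP-κ output distribution p_κ(y) = p(y) · 1{y ∈ A} / ν. Then for every q ∈ Q, Δ_max(p_κ ‖ q) ≤ κ + log(1/ν); that is, the CP-κ rejection-sampling output is k-NAF with respect to Q under Δ_max for every k > κ + log(1/ν). -/

import Mathlib

/-- CP-κ guarantee: let `p` be a pmf on a finite set `Y`, `Q` a finite nonempty set of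
safe pmfs, `κ ≥ 0`, `A = {y | ∀ q ∈ Q, p y ≤ e^κ * q y}` the acceptance set,
`ν = ∑ y ∈ A, p y > 0` the acceptance probability, and `pκ = p · 1_A / ν` the CP-κ
output distribution. Then for every `q ∈ Q`,
`Δ_max(pκ ‖ q) ≤ κ + log (1/ν)` (stated pointwise on the support of `pκ`),
hence `pκ` is `k`-NAF w.r.t. `Q` under `Δ_max` for every `k > κ + log (1/ν)`. -/
theorem cpKappa_naf {Y : Type*} [Fintype Y] [DecidableEq Y] (p : Y → ℝ)
    (hp : ∀ y, 0 ≤ p y) (hps : ∑ y, p y = 1)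
    (Q : Finset (Y → ℝ)) (hQne : Q.Nonempty)
    (hQ : ∀ q ∈ Q, (∀ y, 0 ≤ q y) ∧ ∑ y, q y = 1)
    (κ : ℝ) (hκ : 0 ≤ κ)
    (A : Finset Y) (hA : ∀ y, y ∈ A ↔ ∀ q ∈ Q, p y ≤ Real.exp κ * q y)
    (ν : ℝ) (hν : ν = ∑ y ∈ A, p y) (hνpos : 0 < ν)
    (pκ : Y → ℝ) (hpκ : ∀ y, pκ y = if y ∈ A then p y / ν else 0) :
    ∀ q ∈ Q, ∀ y, 0 < pκ y → Real.log (pκ y / q y) ≤ κ + Real.log (1 / ν) := by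
  intro q hq y hy
  rw [hpκ] at hy
  split_ifs at hy with hyA
  · have hpy : 0 < p y := (div_pos_iff_of_pos_right hνpos).1 hy
    have hle : p y ≤ Real.exp κ * q y := (hA y).1 hyA q hq
    have hqy : 0 < q y := pos_of_mul_pos_right (hpy.trans_le hle) (Real.exp_pos κ).le
    have hratio : p y / ν / q y ≤ Real.exp κ * (1 / ν) := by
      rw [div_right_comm, mul_one_div]
      gcongr
      exact (div_le_iff₀ hqy).2 hle
    rw [hpκ, if_pos hyA]
    calc Real.log (p y / ν / q y) ≤ Real.log (Real.exp κ * (1 / ν)) :=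
          Real.log_le_log (div_pos hy hqy) hratio
      _ = κ + Real.log (1 / ν) := by
          rw [Real.log_mul (Real.exp_ne_zero κ) (one_div_pos.2 hνpos).ne', Real.log_exp]
  · exact absurd hy (lt_irrefl 0)
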